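/- Single-token form of Proposition 1 (exact): suppose f, g : Y → ℝ are logits representing the Gibbs policy and the reference distribution, i.e., Softmax(f)(y) = π*_β(y) and Softmax(g)(y) = π_ref(y) for all y ∈ Y. Then for every λ > 0 and every y ∈ Y, the Gibbs policy at KL coefficient β/λ satisfies π*_{β/λ}(y) = Softmax(λ·f + (1−λ)·g)(y). -/

import Mathlib

/-- If the normalization of `exp ∘ f` equals the normalization of a positive weight `w`, then `f` is
`log ∘ w` up to an additive constant. -/
theorem exists_eq_log_add_of_softmax_eq {Y : Type*} [Fintype Y] [Nonempty Y] {f w : Y → ℝ}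
    (hw : ∀ y, 0 < w y)
    (h : ∀ y, Real.exp (f y) / ∑ y', Real.exp (f y') = w y / ∑ y', w y') :
    ∃ c : ℝ, ∀ y, f y = Real.log (w y) + c := by
  have hF : 0 < ∑ y', Real.exp (f y') :=
    Finset.sum_pos (fun y _ => Real.exp_pos _) Finset.univ_nonempty
  have hW : 0 < ∑ y', w y' := Finset.sum_pos (fun y _ => hw y) Finset.univ_nonempty
  refine ⟨Real.log (∑ y', Real.exp (f y')) - Real.log (∑ y', w y'), fun y => ?_⟩
  have hlog := congrArg Real.log (h y)
  rw [Real.log_div (Real.exp_pos _).ne' hF.ne', Real.log_div (hw y).ne' hW.ne',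
    Real.log_exp] at hlog
  linarith

/-- single-token form of Proposition 1, exact: if f and g are logits
representing the Gibbs policy π*_β and the reference distribution π_ref, then for
every λ > 0 the Gibbs policy at KL coefficient β/λ is the softmax of the arithmetic
mean of logits λ·f + (1−λ)·g. -/
theorem gibbs_policy_perturbed_softmax
    {Y : Type*} [Fintype Y] [Nonempty Y]
    (πref : Y → ℝ) (href_pos : ∀ y, 0 < πref y) (href_sum : ∑ y, πref y = 1)
    (r : Y → ℝ) (β : ℝ) (hβ : 0 < β)
    (softmax : (Y → ℝ) → Y → ℝ)
    (hsoftmax : ∀ f y, softmax f y = Real.exp (f y) / ∑ y', Real.exp (f y'))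
    (f g : Y → ℝ)
    (hf : ∀ y, softmax f y =
      πref y * Real.exp (r y / β) / ∑ y', πref y' * Real.exp (r y' / β))
    (hg : ∀ y, softmax g y = πref y) :
    ∀ lam : ℝ, 0 < lam → ∀ y : Y,
      πref y * Real.exp (r y / (β / lam)) /
          (∑ y', πref y' * Real.exp (r y' / (β / lam))) =
        softmax (fun y' => lam * f y' + (1 - lam) * g y') y := by
  intro lam _ y
  obtain ⟨a, ha⟩ := exists_eq_log_add_of_softmax_eq
    (fun y => mul_pos (href_pos y) (Real.exp_pos (r y / β)))
    (fun y => (hsoftmax f y).symm.trans (hf y))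
  obtain ⟨b, hb⟩ := exists_eq_log_add_of_softmax_eq href_pos
    (fun y => (hsoftmax g y).symm.trans ((hg y).trans (by rw [href_sum, div_one])))
  have key : ∀ y, Real.exp (lam * f y + (1 - lam) * g y) =
      Real.exp (lam * a + (1 - lam) * b) * (πref y * Real.exp (r y / (β / lam))) := by
    intro y
    rw [ha, hb, Real.log_mul (href_pos y).ne' (Real.exp_pos _).ne', Real.log_exp]
    conv_rhs => rw [← Real.exp_log (href_pos y), ← Real.exp_add, ← Real.exp_add]
    congr 1
    rw [div_div_eq_mul_div]
    ring
  simp only [hsoftmax, key, ← Finset.mul_sum]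
  rw [mul_div_mul_left _ _ (Real.exp_pos _).ne']
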